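/- Let X1, X2, U be finitely-valued random variables forming a Markov chain X1 − U − X2, and let K ≥ 2 be an integer. Set ρ0 = I((X1,X2); U), ρ1 = H(X1|U), ρ2 = H(X2|U), γ_K = (1/K)·min{ρ1,ρ2}, and λ_K = ρ0+ρ1+ρ2−2γ_K. Define R̄_MR(M) on [0, H(X1,X2)] by: R̄_MR(M) = ρ0 + (1−1/2^K)(ρ1+ρ2) − (3/2 − 2/2^K)M for M ∈ [0, 2γ_K); R̄_MR(M) = ρ0 + (1−1/2^K)(ρ1+ρ2) − (1−4/2^K)γ_K − M for M ∈ [2γ_K, ρ0+2γ_K); R̄_MR(M) = (1−1/2^K)(ρ0+ρ1+ρ2−M) − (1−2/2^K)γ_K for M ∈ [ρ0+2γ_K, λ_K); R̄_MR(M) = (1/2)(ρ0+ρ1+ρ2−M) for M ∈ [λ_K, ρ0+ρ1+ρ2]. Define R̄_lb(M) = max{(1/2)H(X1,X2) + (1/4)(H(X1)+H(X2)) − M, (1/2)H(X1,X2) + (1/4)max{H(X1),H(X2)} − (3/4)M, (1/2)(H(X1,X2)−M)}. Then R̄_MR(M) = R̄_lb(M) for all M ∈ [H(X1,X2)−2γ_K,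 H(X1,X2)], and R̄_MR(M) − R̄_lb(M) ≤ (1/4)(H(X1|X2)+H(X2|X1)) − (1/2^K)(H(X1|U)+H(X2|U)) for all M ∈ [0, H(X1,X2)]. -/

import Mathlib

open Real

/-- Distribution (pmf) of the random variable `X` under the pmf `p` on the sample space. -/
noncomputable def distOf {Ω A : Type*} [Fintype Ω] [DecidableEq A]
    (p : Ω → ℝ) (X : Ω → A) (a : A) : ℝ :=
  ∑ ω ∈ Finset.univ.filter (fun ω => X ω = a), p ω

/-- Shannon entropy of the random variable `X` under the pmf `p`. -/
noncomputable def ent {Ω A : Type*} [Fintype Ω] [Fintype A] [DecidableEq A]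
    (p : Ω → ℝ) (X : Ω → A) : ℝ :=
  ∑ a, Real.negMulLog (distOf p X a)

/-- Conditional entropy `H(X | Y) = H(X, Y) - H(Y)`. -/
noncomputable def condEnt {Ω A B : Type*} [Fintype Ω] [Fintype A] [Fintype B]
    [DecidableEq A] [DecidableEq B] (p : Ω → ℝ) (X : Ω → A) (Y : Ω → B) : ℝ :=
  ent p (fun ω => (X ω, Y ω)) - ent p Y

/-- Mutual information `I(X; Y) = H(X) + H(Y) - H(X, Y)`. -/
noncomputable def mutInfo {Ω A B : Type*} [Fintype Ω] [Fintype A] [Fintype B]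
    [DecidableEq A] [DecidableEq B] (p : Ω → ℝ) (X : Ω → A) (Y : Ω → B) : ℝ :=
  ent p X + ent p Y - ent p (fun ω => (X ω, Y ω))

/-- `p` is a probability mass function. -/
def IsPMF {Ω : Type*} [Fintype Ω] (p : Ω → ℝ) : Prop :=
  (∀ ω, 0 ≤ p ω) ∧ ∑ ω, p ω = 1

/-- `X1 − U − X2` is a Markov chain: `X1` and `X2` are conditionally independent given `U`. -/
def MarkovTriple {Ω A B C : Type*} [Fintype Ω] [DecidableEq A] [DecidableEq B] [DecidableEq C]
    (p : Ω → ℝ) (X1 : Ω → A) (X2 : Ω → B) (U : Ω → C) : Prop :=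
  ∀ x1 x2 u,
    distOf p (fun ω => (X1 ω, X2 ω, U ω)) (x1, x2, u) * distOf p U u =
    distOf p (fun ω => (X1 ω, U ω)) (x1, u) * distOf p (fun ω => (X2 ω, U ω)) (x2, u)

section Entropy

variable {Ω A B C : Type*} [Fintype Ω] [DecidableEq A] [DecidableEq B] [DecidableEq C]

lemma sum_mul_comp_eq_sum_distOf [Fintype A] (p : Ω → ℝ) (X : Ω → A) (g : A → ℝ) :
    ∑ ω, p ω * g (X ω) = ∑ a, distOf p X a * g a := by
  rw [← Finset.sum_fiberwise Finset.univ X]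
  refine Finset.sum_congr rfl fun a _ => ?_
  rw [distOf, Finset.sum_mul]
  refine Finset.sum_congr rfl fun ω hω => ?_
  rw [(Finset.mem_filter.1 hω).2]

lemma ent_eq_neg_sum_log [Fintype A] (p : Ω → ℝ) (X : Ω → A) :
    ent p X = -∑ ω, p ω * Real.log (distOf p X (X ω)) := by
  rw [sum_mul_comp_eq_sum_distOf p X fun a => Real.log (distOf p X a), ent,
    ← Finset.sum_neg_distrib]
  exact Finset.sum_congr rfl fun a _ => by rw [Real.negMulLog, neg_mul]

/-- Entropy only depends on the partition of the sample space induced by the variable. -/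
lemma ent_congr [Fintype A] [Fintype B] (p : Ω → ℝ) (X : Ω → A) (Y : Ω → B)
    (h : ∀ ω ω', X ω = X ω' ↔ Y ω = Y ω') : ent p X = ent p Y := by
  simp only [ent_eq_neg_sum_log, distOf, h]

lemma distOf_nonneg {p : Ω → ℝ} (hp : IsPMF p) (X : Ω → A) (a : A) : 0 ≤ distOf p X a :=
  Finset.sum_nonneg fun ω _ => hp.1 ω

lemma distOf_apply_pos {p : Ω → ℝ} (hp : IsPMF p) (X : Ω → A) {ω : Ω} (hω : 0 < p ω) :
    0 < distOf p X (X ω) :=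
  hω.trans_le (Finset.single_le_sum (f := p) (fun ω _ => hp.1 ω) (by simp))

lemma sum_distOf_prod_left [Fintype A] (p : Ω → ℝ) (X : Ω → A) (Z : Ω → C) (z : C) :
    ∑ x, distOf p (fun ω => (X ω, Z ω)) (x, z) = distOf p Z z := by
  simp only [distOf, Prod.mk.injEq]
  rw [← Finset.sum_fiberwise _ X]
  refine Finset.sum_congr rfl fun a _ => ?_
  rw [Finset.filter_filter]
  simp only [and_comm]

lemma sum_distOf [Fintype A] {p : Ω → ℝ} (hp : IsPMF p) (X : Ω → A) :
    ∑ a, distOf p X a = 1 := by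
  have h := sum_mul_comp_eq_sum_distOf p X fun _ => 1
  simp only [mul_one] at h
  rw [← h, hp.2]

lemma MarkovTriple.symm {p : Ω → ℝ} {X : Ω → A} {Y : Ω → B} {Z : Ω → C}
    (h : MarkovTriple p X Y Z) : MarkovTriple p Y X Z := by
  intro y x z
  rw [mul_comm (distOf p (fun ω => (Y ω, Z ω)) _), ← h x y z]
  simp only [distOf, Prod.mk.injEq, and_left_comm]

variable [Fintype A] [Fintype B] [Fintype C]

/-- Conditional mutual information is nonnegative: `I(X; Y | Z) ≥ 0`. -/
lemma ent_submodular {p : Ω → ℝ} (hp : IsPMF p) (X : Ω → A) (Y : Ω → B) (Z : Ω → C) :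
    ent p (fun ω => (X ω, Y ω, Z ω)) + ent p Z ≤
      ent p (fun ω => (X ω, Z ω)) + ent p (fun ω => (Y ω, Z ω)) := by
  set PXYZ := distOf p (fun ω => (X ω, Y ω, Z ω)) with hPXYZ
  set PXZ := distOf p (fun ω => (X ω, Z ω)) with hPXZ
  set PYZ := distOf p (fun ω => (Y ω, Z ω)) with hPYZ
  set PZ := distOf p Z with hPZ
  let g : A × B × C → ℝ := fun v => PXZ (v.1, v.2.2) * PYZ v.2 / (PZ v.2.2 * PXYZ v)
  have hg : ∑ ω, p ω * g (X ω, Y ω, Z ω) ≤ 1 := by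
    rw [sum_mul_comp_eq_sum_distOf p (fun ω => (X ω, Y ω, Z ω)) g, ← hPXYZ]
    calc ∑ v, PXYZ v * g v
        ≤ ∑ v : A × B × C, PXZ (v.1, v.2.2) * PYZ v.2 / PZ v.2.2 := by
          refine Finset.sum_le_sum fun v _ => ?_
          have h1 := distOf_nonneg hp (fun ω => (X ω, Z ω)) (v.1, v.2.2)
          have h2 := distOf_nonneg hp (fun ω => (Y ω, Z ω)) v.2
          have h3 := distOf_nonneg hp Z v.2.2
          rcases eq_or_ne (PXYZ v) 0 with h | h
          · rw [h, zero_mul]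
            positivity
          · refine le_of_eq ?_
            simp only [g]
            rw [mul_comm (PZ _), ← div_div, div_right_comm, mul_div_cancel₀ _ h]
      _ = ∑ z, PZ z * PZ z / PZ z := by
          simp only [Fintype.sum_prod_type]
          rw [Finset.sum_congr rfl fun x _ => Finset.sum_comm, Finset.sum_comm]
          refine Finset.sum_congr rfl fun z _ => ?_
          simp only [← Finset.sum_div, ← Finset.mul_sum, ← Finset.sum_mul]
          rw [hPXZ, hPYZ, sum_distOf_prod_left, sum_distOf_prod_left]
      _ = ∑ z, PZ z := Finset.sum_congr rfl fun z _ => mul_self_div_self _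
      _ = 1 := sum_distOf hp Z
      _ ≤ 1 := le_rfl
  have hterm : ∀ ω, p ω - p ω * g (X ω, Y ω, Z ω) ≤
      p ω * Real.log (PXYZ (X ω, Y ω, Z ω)) + p ω * Real.log (PZ (Z ω))
        - p ω * Real.log (PXZ (X ω, Z ω)) - p ω * Real.log (PYZ (Y ω, Z ω)) := by
    intro ω
    rcases (hp.1 ω).eq_or_lt with h | h
    · simp [← h]
    have h1 : 0 < PXYZ (X ω, Y ω, Z ω) := distOf_apply_pos hp (fun ω => (X ω, Y ω, Z ω)) h
    have h2 : 0 < PXZ (X ω, Z ω) := distOf_apply_pos hp (fun ω => (X ω, Z ω)) h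
    have h3 : 0 < PYZ (Y ω, Z ω) := distOf_apply_pos hp (fun ω => (Y ω, Z ω)) h
    have h4 : 0 < PZ (Z ω) := distOf_apply_pos hp Z h
    have hlog := Real.log_le_sub_one_of_pos (x := g (X ω, Y ω, Z ω)) (by simp only [g]; positivity)
    have heq : Real.log (g (X ω, Y ω, Z ω)) =
        Real.log (PXZ (X ω, Z ω)) + Real.log (PYZ (Y ω, Z ω))
          - (Real.log (PZ (Z ω)) + Real.log (PXYZ (X ω, Y ω, Z ω))) := by
      simp only [g]
      rw [Real.log_div (by positivity) (by positivity), Real.log_mul h2.ne' h3.ne',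
        Real.log_mul h4.ne' h1.ne']
    rw [heq] at hlog
    nlinarith
  have hsum := Finset.sum_le_sum fun ω (_ : ω ∈ Finset.univ) => hterm ω
  simp only [Finset.sum_sub_distrib, Finset.sum_add_distrib, hp.2] at hsum
  simp only [ent_eq_neg_sum_log, ← hPXYZ, ← hPXZ, ← hPYZ, ← hPZ]
  linarith

lemma MarkovTriple.ent_add_ent {p : Ω → ℝ} (hp : IsPMF p) {X : Ω → A} {Y : Ω → B} {Z : Ω → C}
    (h : MarkovTriple p X Y Z) :
    ent p (fun ω => (X ω, Y ω, Z ω)) + ent p Z =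
      ent p (fun ω => (X ω, Z ω)) + ent p (fun ω => (Y ω, Z ω)) := by
  simp only [ent_eq_neg_sum_log, ← neg_add, ← Finset.sum_add_distrib]
  refine congrArg _ (Finset.sum_congr rfl fun ω _ => ?_)
  rcases (hp.1 ω).eq_or_lt with hω | hω
  · simp [← hω]
  have h1 := (distOf_apply_pos hp (fun ω => (X ω, Y ω, Z ω)) hω).ne'
  have h2 := (distOf_apply_pos hp (fun ω => (X ω, Z ω)) hω).ne'
  have h3 := (distOf_apply_pos hp (fun ω => (Y ω, Z ω)) hω).ne'
  have h4 := (distOf_apply_pos hp Z hω).ne'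
  rw [← mul_add, ← mul_add, ← Real.log_mul h1 h4, ← Real.log_mul h2 h3, h]

lemma condEnt_nonneg {p : Ω → ℝ} (hp : IsPMF p) (X : Ω → A) (Z : Ω → C) : 0 ≤ condEnt p X Z := by
  have h := ent_submodular hp X X Z
  rw [ent_congr p (fun ω => (X ω, X ω, Z ω)) (fun ω => (X ω, Z ω))
    fun ω ω' => by simp] at h
  rw [condEnt]
  linarith

lemma condEnt_le_ent {p : Ω → ℝ} (hp : IsPMF p) (X : Ω → A) (Y : Ω → B) :
    condEnt p X Y ≤ ent p X := by
  have h := ent_submodular hp X Y fun _ => ()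
  have h0 : ent p (fun _ : Ω => ()) = 0 := by simp [ent, distOf, hp.2]
  rw [ent_congr p (fun ω => (X ω, Y ω, ())) (fun ω => (X ω, Y ω)) fun ω ω' => by simp,
    ent_congr p (fun ω => (X ω, ())) X fun ω ω' => by simp,
    ent_congr p (fun ω => (Y ω, ())) Y fun ω ω' => by simp, h0] at h
  rw [condEnt]
  linarith

lemma mutInfo_nonneg {p : Ω → ℝ} (hp : IsPMF p) (X : Ω → A) (Y : Ω → B) : 0 ≤ mutInfo p X Y := by
  have h := condEnt_le_ent hp X Y
  rw [condEnt] at h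
  rw [mutInfo]
  linarith

lemma ent_prod_comm (p : Ω → ℝ) (X : Ω → A) (Y : Ω → B) :
    ent p (fun ω => (Y ω, X ω)) = ent p (fun ω => (X ω, Y ω)) :=
  ent_congr p _ _ fun ω ω' => by simp [and_comm]

/-- Under `X − Z − Y`, conditioning `X` on `Z` removes at least as much uncertainty as
conditioning on `Y`. -/
lemma MarkovTriple.condEnt_le_condEnt {p : Ω → ℝ} (hp : IsPMF p) {X : Ω → A} {Y : Ω → B}
    {Z : Ω → C} (h : MarkovTriple p X Y Z) : condEnt p X Z ≤ condEnt p X Y := by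
  have h1 := h.ent_add_ent hp
  have h2 := ent_submodular hp X Z Y
  rw [ent_congr p (fun ω => (X ω, Z ω, Y ω)) (fun ω => (X ω, Y ω, Z ω))
    fun ω ω' => by simp [and_comm], ent_prod_comm p Y Z] at h2
  simp only [condEnt]
  linarith

lemma MarkovTriple.ent_prod_eq {p : Ω → ℝ} (hp : IsPMF p) {X : Ω → A} {Y : Ω → B}
    {Z : Ω → C} (h : MarkovTriple p X Y Z) :
    ent p (fun ω => (X ω, Y ω)) =
      mutInfo p (fun ω => (X ω, Y ω)) Z + condEnt p X Z + condEnt p Y Z := by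
  have h1 := h.ent_add_ent hp
  rw [mutInfo, condEnt, condEnt, ent_congr p (fun ω => ((X ω, Y ω), Z ω))
    (fun ω => (X ω, Y ω, Z ω)) fun ω ω' => by simp [and_assoc]]
  linarith

end Entropy

lemma add_two_le_two_pow {n : ℕ} (hn : 2 ≤ n) : n + 2 ≤ 2 ^ n := by
  induction n, hn using Nat.le_induction with
  | base => norm_num
  | succ n _ ih => rw [pow_succ]; omega

/-- In the third memory regime, the first or the second cut-set bound gives the gap estimate. -/
lemma cutset_bound_of_regime_three {k q γ ρ0 ρ1 ρ2 H1 H2 M : ℝ} (hq : 0 < q) (hq4 : q ≤ 1 / 4)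
    (hkq : q * (k + 2) ≤ 1) (hγ0 : 0 ≤ γ) (hγ : k * γ = min ρ1 ρ2)
    (h1 : H1 ≤ ρ0 + ρ1) (h2 : H2 ≤ ρ0 + ρ2) :
    (1 - q) * (ρ0 + ρ1 + ρ2 - M) - (1 - 2 * q) * γ -
        ((ρ0 + ρ1 + ρ2) / 2 + (H1 + H2) / 4 - M) ≤
      (ρ0 + ρ1 + ρ2) / 2 - (H1 + H2) / 4 - q * (ρ1 + ρ2) ∨
    (1 - q) * (ρ0 + ρ1 + ρ2 - M) - (1 - 2 * q) * γ -
        ((ρ0 + ρ1 + ρ2) / 2 + max H1 H2 / 4 - 3 / 4 * M) ≤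
      (ρ0 + ρ1 + ρ2) / 2 - (H1 + H2) / 4 - q * (ρ1 + ρ2) := by
  rcases le_or_gt (q * (M - ρ0)) ((1 - 2 * q) * γ) with h | h
  · left
    linarith
  right
  have hscaled : q * ((k - 4 * (1 - 2 * q)) * γ) ≤ q * ((1 - 4 * q) * (M - ρ0)) := by
    have ha := mul_le_mul_of_nonneg_left h.le (by linarith : 0 ≤ 1 - 4 * q)
    have hb := mul_le_mul_of_nonneg_right hkq hγ0
    linarith
  have hm := le_of_mul_le_mul_left hscaled hq
  have hmin : min H1 H2 ≤ ρ0 + k * γ := by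
    rw [hγ, ← min_add_add_left]
    exact min_le_min h1 h2
  have hadd := min_add_max H1 H2
  linarith

theorem stmt10 {Ω A B C : Type*} [Fintype Ω] [Fintype A] [Fintype B] [Fintype C]
    [DecidableEq A] [DecidableEq B] [DecidableEq C]
    (p : Ω → ℝ) (hp : IsPMF p)
    (X1 : Ω → A) (X2 : Ω → B) (U : Ω → C)
    (hMarkov : MarkovTriple p X1 X2 U)
    (K : ℕ) (hK : 2 ≤ K)
    (ρ0 ρ1 ρ2 γK lamK : ℝ)
    (hρ0 : ρ0 = mutInfo p (fun ω => (X1 ω, X2 ω)) U)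
    (hρ1 : ρ1 = condEnt p X1 U)
    (hρ2 : ρ2 = condEnt p X2 U)
    (hγ : γK = (1 / (K : ℝ)) * min ρ1 ρ2)
    (hlam : lamK = ρ0 + ρ1 + ρ2 - 2 * γK)
    (RMRbar Rlbbar : ℝ → ℝ)
    (hRMRbar : ∀ M, RMRbar M =
      if M < 2 * γK then ρ0 + (1 - 1/(2:ℝ)^K) * (ρ1 + ρ2) - (3/2 - 2/(2:ℝ)^K) * M
      else if M < ρ0 + 2 * γK then ρ0 + (1 - 1/(2:ℝ)^K) * (ρ1 + ρ2) - (1 - 4/(2:ℝ)^K) * γK - M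
      else if M < lamK then (1 - 1/(2:ℝ)^K) * (ρ0 + ρ1 + ρ2 - M) - (1 - 2/(2:ℝ)^K) * γK
      else (1/2) * (ρ0 + ρ1 + ρ2 - M))
    (hRlbbar : ∀ M, Rlbbar M =
      max ((1/2) * ent p (fun ω => (X1 ω, X2 ω)) + (1/4) * (ent p X1 + ent p X2) - M)
        (max ((1/2) * ent p (fun ω => (X1 ω, X2 ω)) + (1/4) * max (ent p X1) (ent p X2) - (3/4) * M)
             ((1/2) * (ent p (fun ω => (X1 ω, X2 ω)) - M)))) :
    (∀ M ∈ Set.Icc (ent p (fun ω => (X1 ω, X2 ω)) - 2 * γK) (ent p (fun ω => (X1 ω, X2 ω))),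
      RMRbar M = Rlbbar M) ∧
    (∀ M ∈ Set.Icc (0:ℝ) (ent p (fun ω => (X1 ω, X2 ω))),
      RMRbar M - Rlbbar M ≤
        (1/4) * (condEnt p X1 X2 + condEnt p X2 X1)
          - (1/(2:ℝ)^K) * (condEnt p X1 U + condEnt p X2 U)) := by
  set H := ent p (fun ω => (X1 ω, X2 ω))
  set H1 := ent p X1
  set H2 := ent p X2
  have hsum : H = ρ0 + ρ1 + ρ2 := by rw [hρ0, hρ1, hρ2]; exact hMarkov.ent_prod_eq hp
  have h0 : 0 ≤ ρ0 := hρ0 ▸ mutInfo_nonneg hp _ _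
  have h1 : 0 ≤ ρ1 := hρ1 ▸ condEnt_nonneg hp _ _
  have h2 : 0 ≤ ρ2 := hρ2 ▸ condEnt_nonneg hp _ _
  have hc1 : condEnt p X1 X2 = H - H2 := rfl
  have hc2 : condEnt p X2 X1 = H - H1 := by rw [condEnt, ent_prod_comm p X1 X2]
  have hle1 : ρ1 ≤ H - H2 := by
    rw [hρ1, ← hc1]; exact hMarkov.condEnt_le_condEnt hp
  have hle2 : ρ2 ≤ H - H1 := by
    rw [hρ2, ← hc2]; exact hMarkov.symm.condEnt_le_condEnt hp
  have hK' : (2 : ℝ) ≤ K := by exact_mod_cast hK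
  have hKγ : K * γK = min ρ1 ρ2 := by
    rw [hγ]; field_simp
  have hmin0 : 0 ≤ min ρ1 ρ2 := le_min h1 h2
  have hγ0 : 0 ≤ γK := by rw [hγ]; positivity
  have hγ1 : 2 * γK ≤ ρ1 :=
    (mul_le_mul_of_nonneg_right hK' hγ0).trans (hKγ.trans_le (min_le_left _ _))
  have hγ2 : 2 * γK ≤ ρ2 :=
    (mul_le_mul_of_nonneg_right hK' hγ0).trans (hKγ.trans_le (min_le_right _ _))
  have hpow : (K : ℝ) + 2 ≤ 2 ^ K := by exact_mod_cast add_two_le_two_pow hK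
  obtain ⟨q, hq⟩ : ∃ q : ℝ, q = 1 / 2 ^ K := ⟨_, rfl⟩
  have hqpos : 0 < q := by rw [hq]; positivity
  have hkq : q * (K + 2) ≤ 1 := by
    rw [hq, one_div, inv_mul_le_iff₀ (by positivity)]; linarith
  have hq4 : q ≤ 1 / 4 := by nlinarith
  have hdiv : ∀ c : ℝ, c / 2 ^ K = c * q := fun c => by rw [hq, mul_one_div]
  simp only [hdiv] at hRMRbar ⊢
  rw [← hρ1, ← hρ2, hc1, hc2]
  constructor
  · rintro M ⟨hM, -⟩
    rw [hRMRbar, hRlbbar, if_neg (by linarith), if_neg (by linarith), if_neg (by linarith),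
      ← hsum]
    have hmax : max H1 H2 ≤ M := max_le (by linarith) (by linarith)
    rw [max_eq_right, max_eq_right]
    · linarith
    · exact le_max_of_le_right (by linarith)
  · rintro M ⟨hM, -⟩
    have hA : _ ≤ Rlbbar M := (le_max_left _ _).trans (hRlbbar M).ge
    have hB : _ ≤ Rlbbar M :=
      ((le_max_left _ _).trans (le_max_right _ _)).trans (hRlbbar M).ge
    have hC : _ ≤ Rlbbar M :=
      ((le_max_right _ _).trans (le_max_right _ _)).trans (hRlbbar M).ge
    rw [hRMRbar]
    split_ifs
    · have := mul_nonneg (by linarith : 0 ≤ 1 / 2 - 2 * q) hM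
      linarith
    · have := mul_nonneg (by linarith : 0 ≤ 1 - 4 * q) hγ0
      linarith
    · rcases cutset_bound_of_regime_three (M := M) hqpos hq4 hkq hγ0 hKγ
        (by linarith : H1 ≤ ρ0 + ρ1) (by linarith : H2 ≤ ρ0 + ρ2) with h | h <;> linarith
    · have := mul_le_mul_of_nonneg_right hq4 (add_nonneg h1 h2)
      linarith
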